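/- Let m be a positive integer and L, M, N ⊆ [m] with L ≠ [m] and M ≠ [m]. Let D = (1+u^2)Δ_L^c + u^2(Δ_M^c + (u+u^2)Δ_N) ⊆ R^m. Then C_D has length |D| = (2^m − 2^{|L|})(2^m − 2^{|M|})·2^{|N|}, the map c_D : R^m → C_D is injective (its kernel is trivial), and |C_D| = 2^{3m}; in particular the only v ∈ R^m with wt_L(c_D(v)) = 0 is v = 0. -/

import Mathlib

open Polynomial
open scoped Classical

noncomputable section

/-- The ring `R = Z₂[u]/⟨u³ - u⟩`. -/
abbrev Rng : Type := AdjoinRoot (X ^ 3 - X : Polynomial (ZMod 2))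

/-- The image `u` of the variable in `R`. -/
def u : Rng := AdjoinRoot.root (X ^ 3 - X : Polynomial (ZMod 2))

/-- The natural inclusion of `Z₂` into `R`. -/
def toRng : ZMod 2 →+* Rng := AdjoinRoot.of _

lemma cubic_monic : (X ^ 3 - X : Polynomial (ZMod 2)).Monic :=
  Polynomial.monic_X_pow_sub (n := 3) (Polynomial.degree_X_le.trans_lt (by norm_num))

/-- The Gray map `Φ : R → Z₂³`, `Φ(a + u b + u² d) = (a + b, b + d, d)`:
every element of `R` is represented by a unique polynomial of degree `< 3`,
whose coefficients are `a, b, d`. -/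
def Phi (r : Rng) : Fin 3 → ZMod 2 :=
  ![(AdjoinRoot.modByMonicHom cubic_monic r).coeff 0 +
      (AdjoinRoot.modByMonicHom cubic_monic r).coeff 1,
    (AdjoinRoot.modByMonicHom cubic_monic r).coeff 1 +
      (AdjoinRoot.modByMonicHom cubic_monic r).coeff 2,
    (AdjoinRoot.modByMonicHom cubic_monic r).coeff 2]

/-- The support of a vector in `Z₂^m`. -/
def supp {m : ℕ} (v : Fin m → ZMod 2) : Finset (Fin m) :=
  Finset.univ.filter (fun i => v i = 1)

/-- The simplicial complex `Δ_X` generated by `X ⊆ [m]`. -/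
def Δ {m : ℕ} (X : Finset (Fin m)) : Finset (Fin m → ZMod 2) :=
  Finset.univ.filter (fun v => supp v ⊆ X)

/-- The Lee weight of a tuple over `R`: the Hamming weight of its coordinatewise Gray image. -/
def wtL {ι : Type} [Fintype ι] (x : ι → Rng) : ℕ :=
  ∑ i, (Finset.univ.filter (fun j : Fin 3 => Phi (x i) j ≠ 0)).card

/-- The defining set `D = (1+u²)D₁ + u²(D₂ + (u+u²)D₃) ⊆ R^m`. -/
def Dset {m : ℕ} (D1 D2 D3 : Finset (Fin m → ZMod 2)) : Finset (Fin m → Rng) :=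
  ((D1 ×ˢ D2) ×ˢ D3).image (fun t i =>
    (1 + u ^ 2) * toRng (t.1.1 i) +
      u ^ 2 * (toRng (t.1.2 i) + (u + u ^ 2) * toRng (t.2 i)))

/-- The codeword `c_D(v) = (v ⬝ d)_{d ∈ D}` of `C_D`. -/
def cD {m : ℕ} (D : Finset (Fin m → Rng)) (v : Fin m → Rng) : D → Rng :=
  fun d => ∑ i, v i * d.1 i

lemma u_cube : u ^ 3 = u := by
  have h := AdjoinRoot.mk_self (f := (X ^ 3 - X : Polynomial (ZMod 2)))
  rw [map_sub, map_pow, AdjoinRoot.mk_X, sub_eq_zero] at h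
  exact h

lemma two_Rng : (2 : Rng) = 0 := by
  have h : toRng 2 = 0 := by
    rw [show (2 : ZMod 2) = 0 from rfl, map_zero]
  rwa [map_ofNat] at h

/-- Element with components `a`, `b`, `c` in the decomposition used for `D`. -/
def qel (t : (ZMod 2 × ZMod 2) × ZMod 2) : Rng :=
  (1 + u ^ 2) * toRng t.1.1 + u ^ 2 * (toRng t.1.2 + (u + u ^ 2) * toRng t.2)

lemma qel_zero : qel 0 = 0 := by simp [qel]

lemma qel_add (s t : (ZMod 2 × ZMod 2) × ZMod 2) : qel (s + t) = qel s + qel t := by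
  simp only [qel, Prod.fst_add, Prod.snd_add, map_add]; ring

/-- `qel` as an additive hom. -/
def qhom : ((ZMod 2 × ZMod 2) × ZMod 2) →+ Rng where
  toFun := qel
  map_zero' := qel_zero
  map_add' := qel_add

lemma qel_poly (t : (ZMod 2 × ZMod 2) × ZMod 2) :
    qel t = AdjoinRoot.mk _ (C t.1.1 + C t.2 * X + C (t.1.1 + t.1.2 + t.2) * X ^ 2) := by
  have h1 : qel t = toRng t.1.1 + toRng t.2 * u +
      toRng (t.1.1 + t.1.2 + t.2) * u ^ 2 := by
    simp only [qel, map_add]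
    linear_combination (toRng t.2 + u * toRng t.2) * u_cube
  rw [h1]
  simp only [map_add, map_mul, map_pow, AdjoinRoot.mk_X, AdjoinRoot.mk_C, u, toRng]

lemma qel_mod (t : (ZMod 2 × ZMod 2) × ZMod 2) :
    AdjoinRoot.modByMonicHom cubic_monic (qel t) =
      C t.1.1 + C t.2 * X + C (t.1.1 + t.1.2 + t.2) * X ^ 2 := by
  rw [qel_poly, AdjoinRoot.modByMonicHom_mk]
  rw [Polynomial.modByMonic_eq_self_iff cubic_monic]
  have h3 : (X ^ 3 - X : Polynomial (ZMod 2)).degree = 3 := by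
    compute_degree!
  rw [h3]
  have : (C t.1.1 + C t.2 * X + C (t.1.1 + t.1.2 + t.2) * X ^ 2 :
      Polynomial (ZMod 2)).degree ≤ 2 := by
    compute_degree
  exact this.trans_lt (by norm_num)

lemma qel_Phi (t : (ZMod 2 × ZMod 2) × ZMod 2) :
    Phi (qel t) = ![t.1.1 + t.2, t.2 + (t.1.1 + t.1.2 + t.2), t.1.1 + t.1.2 + t.2] := by
  simp only [Phi, qel_mod]
  generalize t.1.1 + t.1.2 + t.2 = z
  simp [coeff_X, coeff_C, coeff_X_pow]

lemma qel_Phi_eq_zero (t : (ZMod 2 × ZMod 2) × ZMod 2) (h : Phi (qel t) = 0) : t = 0 := by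
  rw [qel_Phi] at h
  have h0 := congrFun h 0
  have h1 := congrFun h 1
  have h2 := congrFun h 2
  simp at h0 h1 h2
  obtain ⟨⟨a, b⟩, c⟩ := t
  simp only at h0 h1 h2
  revert a b c
  decide

lemma qhom_inj : Function.Injective qhom := by
  rw [injective_iff_map_eq_zero]
  intro t ht
  apply qel_Phi_eq_zero
  have : qel t = qel 0 := by rw [qel_zero]; exact ht
  rw [this, qel_Phi]
  ext i; fin_cases i <;> simp

lemma qhom_surj : Function.Surjective qhom := by
  intro r
  induction r using AdjoinRoot.induction_on with
  | ih p =>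
    have hq : ∃ a b c : ZMod 2, p %ₘ (X ^ 3 - X) = C a + C b * X + C c * X ^ 2 := by
      have hd : (p %ₘ (X ^ 3 - X)).natDegree < 3 := by
        have h3 : (X ^ 3 - X : Polynomial (ZMod 2)).natDegree = 3 := by
          compute_degree!
        have := Polynomial.natDegree_modByMonic_lt p cubic_monic (by
          intro h; rw [h] at h3; simp at h3)
        omega
      refine ⟨(p %ₘ (X ^ 3 - X)).coeff 0, (p %ₘ (X ^ 3 - X)).coeff 1,
        (p %ₘ (X ^ 3 - X)).coeff 2, (Polynomial.as_sum_range' _ 3 hd).trans ?_⟩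
      simp only [Finset.sum_range_succ, Finset.sum_range_zero, zero_add,
        ← C_mul_X_pow_eq_monomial, pow_zero, mul_one, pow_one]
    obtain ⟨a, b, c, h⟩ := hq
    refine ⟨((a, a + b + c), b), ?_⟩
    change qel _ = _
    rw [qel_poly]
    have e : a + (a + b + c) + b = c := by clear h; revert a b c; decide
    simp only [e]
    rw [← h, AdjoinRoot.mk_eq_mk]
    refine ⟨-(p /ₘ (X ^ 3 - X)), ?_⟩
    have := Polynomial.modByMonic_add_div p (X ^ 3 - X : Polynomial (ZMod 2))
    linear_combination this

lemma qhom_mul (s t : (ZMod 2 × ZMod 2) × ZMod 2) :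
    qhom s * qhom t =
      qhom ((s.1.1 * t.1.1, s.1.2 * t.1.2), s.1.2 * t.2 + s.2 * t.1.2) := by
  change qel s * qel t = qel _
  simp only [qel, map_add, map_mul]
  have h4 : u ^ 4 = u ^ 2 := by linear_combination u * u_cube
  have h5 : u ^ 5 = u := by linear_combination (u ^ 2 + 1) * u_cube
  have h6 : u ^ 6 = u ^ 2 := by linear_combination (u ^ 3 + u) * u_cube
  have h7 : u ^ 7 = u := by linear_combination (u ^ 4 + u ^ 2 + 1) * u_cube
  have h8 : u ^ 8 = u ^ 2 := by linear_combination (u ^ 5 + u ^ 3 + u) * u_cube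
  have h2 := two_Rng
  ring_nf
  simp only [u_cube, h4, h5, h6, h7, h8]
  ring_nf
  grind

lemma Phi_eq_zero {r : Rng} : Phi r = 0 ↔ r = 0 := by
  constructor
  · intro h
    obtain ⟨t, rfl⟩ := qhom_surj r
    rw [qel_Phi_eq_zero t h, map_zero]
  · rintro rfl
    rw [← qel_zero, qel_Phi]
    ext i; fin_cases i <;> simp

lemma mem_Δ {m : ℕ} {Y : Finset (Fin m)} {v : Fin m → ZMod 2} :
    v ∈ Δ Y ↔ ∀ i, i ∉ Y → v i = 0 := by
  have h01 : ∀ x : ZMod 2, x = 0 ↔ ¬ x = 1 := by decide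
  simp only [Δ, supp, Finset.mem_filter, Finset.mem_univ, true_and, Finset.subset_iff]
  refine forall_congr' fun i => ?_
  rw [h01]; tauto

lemma card_Δ {m : ℕ} (Y : Finset (Fin m)) : (Δ Y).card = 2 ^ Y.card := by
  rw [← Finset.card_powerset]
  refine Finset.card_bij' (fun v _ => supp v) (fun S _ i => if i ∈ S then 1 else 0) ?_ ?_ ?_ ?_
  · intro v hv
    simpa [Δ] using hv
  · intro S hS
    rw [mem_Δ]
    intro i hi
    rw [Finset.mem_powerset] at hS
    have : i ∉ S := fun h => hi (hS h)
    simp [this]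
  · intro v hv
    have h01 : ∀ x : ZMod 2, ¬ x = 1 → 0 = x := by decide
    funext i
    by_cases h : v i = 1
    · simp [supp, h]
    · simp [supp, h, h01 _ h]
  · intro S hS
    ext i
    simp [supp]

lemma card_Δc {m : ℕ} (Y : Finset (Fin m)) :
    (((Δ Y)ᶜ).card : ℤ) = 2 ^ m - 2 ^ Y.card := by
  have h := Finset.card_add_card_compl (Δ Y)
  rw [card_Δ] at h
  simp only [Fintype.card_fun, ZMod.card, Fintype.card_fin] at h
  have h' : ((2 ^ Y.card + ((Δ Y)ᶜ).card : ℕ) : ℤ) = ((2 ^ m : ℕ) : ℤ) := by rw [h]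
  push_cast at h'
  linarith

lemma Δc_nonempty {m : ℕ} {Y : Finset (Fin m)} (hY : Y ≠ Finset.univ) :
    ∃ k, ∀ v : Fin m → ZMod 2, v k = 1 → v ∈ (Δ Y)ᶜ := by
  obtain ⟨k, hk⟩ : ∃ k, k ∉ Y := by
    by_contra h
    push Not at h
    exact hY (Finset.eq_univ_iff_forall.2 h)
  refine ⟨k, fun v hv => ?_⟩
  rw [Finset.mem_compl, mem_Δ]
  intro h
  have := h k hk
  rw [hv] at this
  exact one_ne_zero this

/-- The complement of a proper `Δ_Y` separates vectors. -/
lemma Δc_sep {m : ℕ} {Y : Finset (Fin m)} (hY : Y ≠ Finset.univ) (a : Fin m → ZMod 2)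
    (h : ∀ t ∈ (Δ Y)ᶜ, ∑ i, a i * t i = 0) : a = 0 := by
  obtain ⟨k, hk⟩ := Δc_nonempty hY
  have h1 : a k = 0 := by
    have := h (Pi.single k 1) (hk _ (by simp))
    simpa [Pi.single_apply] using this
  funext j
  by_cases hj : j = k
  · rw [hj, h1]; rfl
  · have := h (Pi.single k 1 + Pi.single j 1) (hk _ (by simp [Pi.single_apply, Ne.symm hj]))
    simpa [Pi.single_apply, mul_add, Finset.sum_add_distrib, h1] using this

lemma Dset_card {m : ℕ} (D1 D2 D3 : Finset (Fin m → ZMod 2)) :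
    (Dset D1 D2 D3).card = D1.card * D2.card * D3.card := by
  rw [Dset, Finset.card_image_of_injective, Finset.card_product, Finset.card_product]
  intro s t h
  have h' : ∀ i, ((s.1.1 i, s.1.2 i), s.2 i) = ((t.1.1 i, t.1.2 i), t.2 i) := fun i =>
    qhom_inj (congrFun h i)
  refine Prod.ext (Prod.ext ?_ ?_) ?_ <;> funext i <;> have := h' i <;>
    simp only [Prod.mk.injEq] at this <;> tauto

lemma cD_ker {m : ℕ} (L M N : Finset (Fin m))
    (hL : L ≠ Finset.univ) (hM : M ≠ Finset.univ) (v : Fin m → Rng)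
    (hv : cD (Dset ((Δ L)ᶜ) ((Δ M)ᶜ) (Δ N)) v = 0) : v = 0 := by
  choose w hw using fun i => qhom_surj (v i)
  have key : ∀ t1 ∈ (Δ L)ᶜ, ∀ t2 ∈ (Δ M)ᶜ,
      ∑ i, (((w i).1.1 * t1 i, (w i).1.2 * t2 i), (w i).2 * t2 i) = 0 := by
    intro t1 h1 t2 h2
    apply qhom_inj
    have h0 : (0 : Fin m → ZMod 2) ∈ Δ N := mem_Δ.2 fun _ _ => rfl
    have := congrFun hv ⟨_, Finset.mem_image_of_mem _
      (Finset.mk_mem_product (Finset.mk_mem_product h1 h2) h0)⟩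
    rw [map_sum, map_zero]
    refine Eq.trans (Finset.sum_congr rfl fun i _ => ?_) this
    rw [← hw i]
    refine Eq.trans ?_ (qhom_mul (w i) ((t1 i, t2 i), 0)).symm
    simp
  obtain ⟨kL, hkL⟩ := Δc_nonempty hL
  obtain ⟨kM, hkM⟩ := Δc_nonempty hM
  have e1 := hkL (fun _ => 1) rfl
  have e2 := hkM (fun _ => 1) rfl
  have ha := Δc_sep hL (fun i => (w i).1.1) fun t ht => by
    simpa [Prod.fst_sum] using congrArg (fun p => p.1.1) (key t ht _ e2)
  have hb := Δc_sep hM (fun i => (w i).1.2) fun t ht => by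
    simpa [Prod.fst_sum, Prod.snd_sum] using congrArg (fun p => p.1.2) (key _ e1 t ht)
  have hc := Δc_sep hM (fun i => (w i).2) fun t ht => by
    simpa [Prod.fst_sum, Prod.snd_sum] using congrArg (fun p => p.2) (key _ e1 t ht)
  funext i
  have hwi : w i = 0 := Prod.ext (Prod.ext (congrFun ha i) (congrFun hb i)) (congrFun hc i)
  rw [← hw i, hwi, map_zero]; rfl

lemma card_Rng : Nat.card Rng = 2 ^ 3 := by
  rw [← Nat.card_eq_of_bijective qhom ⟨qhom_inj, qhom_surj⟩]
  simp [Nat.card_prod]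

lemma wtL_eq_zero {ι : Type} [Fintype ι] (x : ι → Rng) : wtL x = 0 ↔ x = 0 := by
  simp only [wtL, Finset.sum_eq_zero_iff, Finset.mem_univ, true_implies, Finset.card_eq_zero,
    Finset.filter_eq_empty_iff, not_not]
  rw [funext_iff]
  refine forall_congr' fun i => ?_
  rw [Pi.zero_apply, ← Phi_eq_zero, funext_iff]
  rfl

theorem code_LcMcN (m : ℕ) (hm : 0 < m) (L M N : Finset (Fin m))
    (hL : L ≠ Finset.univ) (hM : M ≠ Finset.univ)
    (D : Finset (Fin m → Rng)) (hD : D = Dset ((Δ L)ᶜ) ((Δ M)ᶜ) (Δ N)) :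
    ((D.card : ℤ) = (2 ^ m - 2 ^ L.card) * (2 ^ m - 2 ^ M.card) * 2 ^ N.card) ∧
    Function.Injective (cD D) ∧
    Nat.card (Set.range (cD D)) = 2 ^ (3 * m) ∧
    (∀ v : Fin m → Rng, wtL (cD D v) = 0 ↔ v = 0) := by
  subst hD
  have hinj : Function.Injective (cD (Dset ((Δ L)ᶜ) ((Δ M)ᶜ) (Δ N))) := by
    intro v w h
    rw [← sub_eq_zero]
    apply cD_ker L M N hL hM
    funext d
    have := congrFun h d
    simp only [cD, Pi.sub_apply, sub_mul, Finset.sum_sub_distrib, Pi.zero_apply] at this ⊢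
    rw [this, sub_self]
  refine ⟨?_, hinj, ?_, fun v => ?_⟩
  · rw [Dset_card]
    push_cast
    rw [card_Δc, card_Δc, card_Δ]
    push_cast
    rfl
  · rw [Nat.card_range_of_injective hinj, Nat.card_fun, card_Rng, Nat.card_fin, ← pow_mul]
  · rw [wtL_eq_zero]
    refine ⟨cD_ker L M N hL hM v, ?_⟩
    rintro rfl
    funext d
    simp [cD]


end
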